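/- arXiv:1911.05456 — 2 statements merged into one kernel-verified Lean document; each statement's English description precedes it below -/
import Mathlib

section
/- For every nonnegative integer n, sum over k from 0 to n of C(n,k) * (-1)^k * 4^{n-k} * s_{n+k,k} equals the Franel number f_n = sum over k from 0 to n of C(n,k)^3, where s_{n,k} = (1/C(n,k)) * sum over i from 0 to k of C(n,2i) * C(n,2(k-i)) * C(2i,i) * C(2(k-i), k-i). -/
/-- The rational numbers `s_{n,k}` for `n ≥ k ≥ 0`. -/
def sSeq (n k : ℕ) : ℚ :=
  (1 / (n.choose k : ℚ)) *
    ∑ i ∈ Finset.range (k + 1),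
      (n.choose (2 * i) : ℚ) * (n.choose (2 * (k - i)) : ℚ) *
        ((2 * i).choose i : ℚ) * ((2 * (k - i)).choose (k - i) : ℚ)

open Finset Nat

/-- The reciprocal factorial `1 / m!`, extended by zero to negative integers. -/
def invFact (m : ℤ) : ℚ := if m < 0 then 0 else 1 / (m.toNat ! : ℚ)

theorem invFact_natCast (m : ℕ) : invFact m = 1 / (m ! : ℚ) := by
  simp [invFact]

theorem invFact_of_neg {m : ℤ} (h : m < 0) : invFact m = 0 := by
  simp [invFact, h]

theorem invFact_eq_mul (m : ℤ) : invFact m = (m + 1) * invFact (m + 1) := by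
  rcases lt_or_ge m 0 with h | h
  · rw [invFact_of_neg h]
    rcases (show m + 1 < 0 ∨ m + 1 = 0 by omega) with h' | h'
    · rw [invFact_of_neg h', mul_zero]
    · have : (m : ℚ) + 1 = 0 := by exact_mod_cast h'
      rw [this, zero_mul]
  · lift m to ℕ using h
    have h1 : ((m : ℤ) + 1) = ((m + 1 : ℕ) : ℤ) := by push_cast; rfl
    rw [h1, invFact_natCast, invFact_natCast, factorial_succ]
    have := factorial_ne_zero m
    push_cast
    field_simp

theorem invFact_eq_mul_of_eq {m m' : ℤ} {x : ℚ} (h : m' = m + 1) (hx : x = m + 1) :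
    invFact m = x * invFact m' := by
  rw [invFact_eq_mul m, h, hx]

theorem choose_eq_invFact (N m : ℕ) :
    (N.choose m : ℚ) = N ! / m ! * invFact ((N : ℤ) - m) := by
  rcases le_or_gt m N with h | h
  · rw [← Nat.cast_sub h, invFact_natCast, Nat.cast_choose ℚ h]
    field_simp
  · rw [Nat.choose_eq_zero_of_lt h, invFact_of_neg (by omega)]
    simp

/-- A recurrence of order two satisfied by the Franel numbers. -/
def FranelRec (u : ℕ → ℚ) : Prop :=
  ∀ n : ℕ, ((n : ℚ) + 2) ^ 2 * u (n + 2) =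
    (7 * ((n : ℚ) + 1) ^ 2 + 7 * (n + 1) + 2) * u (n + 1) + 8 * ((n : ℚ) + 1) ^ 2 * u n

theorem FranelRec.eq {u v : ℕ → ℚ} (hu : FranelRec u) (hv : FranelRec v)
    (h0 : u 0 = v 0) (h1 : u 1 = v 1) (n : ℕ) : u n = v n := by
  induction n using Nat.twoStepInduction with
  | zero => exact h0
  | one => exact h1
  | more n ih ih' =>
    have hn : ((n : ℚ) + 2) ^ 2 ≠ 0 := by positivity
    apply mul_left_cancel₀ hn
    rw [hu n, hv n, ih, ih']

/-! ### The Franel numbers -/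

/-- The kernel common to the summands of three consecutive Franel numbers. -/
def franelKernel (n k : ℕ) : ℚ :=
  (n ! : ℚ) ^ 3 / (k ! : ℚ) ^ 3 * invFact ((n : ℤ) + 2 - k) ^ 3

/-- The polynomial part of the telescoping certificate for the Franel recurrence. -/
def franelCert (n k : ℚ) : ℚ :=
  (-72 - 272 * n - 402 * n ^ 2 - 290 * n ^ 3 - 102 * n ^ 4 - 14 * n ^ 5) +
    (78 + 249 * n + 291 * n ^ 2 + 147 * n ^ 3 + 27 * n ^ 4) * k +
    (-30 - 78 * n - 66 * n ^ 2 - 18 * n ^ 3) * k ^ 2 + (4 + 8 * n + 4 * n ^ 2) * k ^ 3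

theorem choose_cube_zero (n k : ℕ) : (n.choose k : ℚ) ^ 3 =
    (((n : ℚ) + 1 - k) * (n + 2 - k)) ^ 3 * franelKernel n k := by
  rw [choose_eq_invFact, franelKernel,
    invFact_eq_mul_of_eq (m := (n : ℤ) - k) (m' := n + 1 - k) (x := n + 1 - k)
      (by ring) (by push_cast; ring),
    invFact_eq_mul_of_eq (m := (n : ℤ) + 1 - k) (m' := n + 2 - k) (x := n + 2 - k)
      (by ring) (by push_cast; ring)]
  ring

theorem choose_cube_one (n k : ℕ) : ((n + 1).choose k : ℚ) ^ 3 =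
    (((n : ℚ) + 1) * (n + 2 - k)) ^ 3 * franelKernel n k := by
  rw [choose_eq_invFact, franelKernel,
    invFact_eq_mul_of_eq (m := ((n + 1 : ℕ) : ℤ) - k) (m' := n + 2 - k) (x := n + 2 - k)
      (by push_cast; ring) (by push_cast; ring), factorial_succ]
  push_cast
  ring

theorem choose_cube_two (n k : ℕ) : ((n + 2).choose k : ℚ) ^ 3 =
    (((n : ℚ) + 1) * (n + 2)) ^ 3 * franelKernel n k := by
  rw [choose_eq_invFact, franelKernel, factorial_succ, factorial_succ]
  push_cast
  ring

theorem franelKernel_succ (n k : ℕ) :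
    ((k : ℚ) + 1) ^ 3 * franelKernel n (k + 1) = ((n : ℚ) + 2 - k) ^ 3 * franelKernel n k := by
  rw [franelKernel, franelKernel,
    invFact_eq_mul_of_eq (m := (n : ℤ) + 2 - (k + 1 : ℕ)) (m' := n + 2 - k) (x := n + 2 - k)
      (by push_cast; ring) (by push_cast; ring), factorial_succ]
  have := factorial_ne_zero k
  push_cast
  field_simp

theorem choose_cube_telescope (n k : ℕ) :
    ((n : ℚ) + 2) ^ 2 * ((n + 2).choose k : ℚ) ^ 3 -
      (7 * ((n : ℚ) + 1) ^ 2 + 7 * (n + 1) + 2) * ((n + 1).choose k : ℚ) ^ 3 -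
      8 * ((n : ℚ) + 1) ^ 2 * (n.choose k : ℚ) ^ 3 =
    ((k + 1 : ℕ) : ℚ) ^ 3 * franelCert n (k + 1 : ℕ) * franelKernel n (k + 1) -
      (k : ℚ) ^ 3 * franelCert n k * franelKernel n k := by
  have h := franelKernel_succ n k
  rw [choose_cube_zero n, choose_cube_one n, choose_cube_two]
  push_cast
  rw [mul_right_comm (((k : ℚ) + 1) ^ 3), h]
  simp only [franelCert]
  ring

theorem sum_choose_cube_extend {n M : ℕ} (h : n + 1 ≤ M) :
    ∑ k ∈ range (n + 1), (n.choose k : ℚ) ^ 3 = ∑ k ∈ range M, (n.choose k : ℚ) ^ 3 := by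
  refine sum_subset (range_subset_range.2 h) fun k _ hk => ?_
  rw [mem_range, not_lt] at hk
  rw [Nat.choose_eq_zero_of_lt (by omega)]
  simp

theorem franelRec_sum_choose_cube :
    FranelRec fun n => ∑ k ∈ range (n + 1), (n.choose k : ℚ) ^ 3 := by
  intro n
  dsimp only
  rw [sum_choose_cube_extend (n := n) (M := n + 3) (by omega),
    sum_choose_cube_extend (n := n + 1) (M := n + 3) (by omega), ← sub_eq_zero, ← sub_sub,
    mul_sum, mul_sum, mul_sum, ← sum_sub_distrib, ← sum_sub_distrib,
    sum_congr rfl fun k _ => choose_cube_telescope n k,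
    sum_range_sub fun k : ℕ => (k : ℚ) ^ 3 * franelCert n k * franelKernel n k]
  rw [franelKernel, invFact_of_neg (by omega)]
  simp

/-! ### The alternating sum of the `s_{n+k,k}` -/

/-- The summand of the double sum obtained by expanding `s_{n+k,k}`, with `k = i + j`. -/
def doubleTerm (n i j : ℕ) : ℚ :=
  (n ! : ℚ) ^ 2 * ((n + i + j)! : ℚ) * 4 ^ n * (-1 / 4) ^ (i + j) /
      ((i ! : ℚ) ^ 2 * (j ! : ℚ) ^ 2) *
    (invFact ((n : ℤ) - i - j) * invFact ((n : ℤ) + i - j) * invFact ((n : ℤ) + j - i))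

/-- The kernel common to `doubleTerm n`, `doubleTerm (n + 1)` and `doubleTerm (n + 2)`. -/
def doubleKernel (n i j : ℕ) : ℚ :=
  (n ! : ℚ) ^ 2 * ((n + i + j)! : ℚ) * 4 ^ n * (-1 / 4) ^ (i + j) /
      ((i ! : ℚ) ^ 2 * (j ! : ℚ) ^ 2) *
    (invFact ((n : ℤ) + 2 - i - j) * invFact ((n : ℤ) + 2 + i - j) *
      invFact ((n : ℤ) + 2 + j - i))

/-- The polynomial part of the telescoping certificate for `doubleTerm`. -/
def doubleCert (n i j : ℚ) : ℚ :=
  (112 + 472 * n + 784 * n ^ 2 + 640 * n ^ 3 + 256 * n ^ 4 + 40 * n ^ 5) +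
    (-408 - 1344 * n - 1632 * n ^ 2 - 864 * n ^ 3 - 168 * n ^ 4) * j +
    (-320 - 840 * n - 720 * n ^ 2 - 200 * n ^ 3) * j ^ 2 +
    (8 - 16 * n - 80 * n ^ 2 - 80 * n ^ 3 - 24 * n ^ 4) * i +
    (-64 - 160 * n - 128 * n ^ 2 - 32 * n ^ 3) * (i * j) +
    (-96 - 248 * n - 208 * n ^ 2 - 56 * n ^ 3) * i ^ 2 +
    8 * (n + 1) ^ 2 * (j ^ 3 - i * j ^ 2 - i ^ 2 * j + i ^ 3)

/-- The antidifference, in its first index, of one half of the recurrence for `doubleTerm`. -/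
def doubleAnti (n i j : ℕ) : ℚ :=
  (i : ℚ) ^ 2 * (n + 2 + i - j) * doubleCert n i j * doubleKernel n i j

theorem doubleKernel_symm (n i j : ℕ) : doubleKernel n i j = doubleKernel n j i := by
  rw [doubleKernel, doubleKernel, add_right_comm n i j, add_comm i j, sub_right_comm]
  ring

theorem doubleTerm_zero (n i j : ℕ) : doubleTerm n i j =
    ((n : ℚ) + 1 - i - j) * (n + 2 - i - j) * ((n + 1 + i - j) * (n + 2 + i - j)) *
      ((n + 1 + j - i) * (n + 2 + j - i)) * doubleKernel n i j := by
  rw [doubleTerm, doubleKernel,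
    invFact_eq_mul_of_eq (m := (n : ℤ) - i - j) (m' := n + 1 - i - j) (x := n + 1 - i - j)
      (by ring) (by push_cast; ring),
    invFact_eq_mul_of_eq (m := (n : ℤ) + 1 - i - j) (m' := n + 2 - i - j) (x := n + 2 - i - j)
      (by ring) (by push_cast; ring),
    invFact_eq_mul_of_eq (m := (n : ℤ) + i - j) (m' := n + 1 + i - j) (x := n + 1 + i - j)
      (by ring) (by push_cast; ring),
    invFact_eq_mul_of_eq (m := (n : ℤ) + 1 + i - j) (m' := n + 2 + i - j) (x := n + 2 + i - j)
      (by ring) (by push_cast; ring),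
    invFact_eq_mul_of_eq (m := (n : ℤ) + j - i) (m' := n + 1 + j - i) (x := n + 1 + j - i)
      (by ring) (by push_cast; ring),
    invFact_eq_mul_of_eq (m := (n : ℤ) + 1 + j - i) (m' := n + 2 + j - i) (x := n + 2 + j - i)
      (by ring) (by push_cast; ring)]
  ring

theorem doubleTerm_one (n i j : ℕ) : doubleTerm (n + 1) i j =
    4 * ((n : ℚ) + 1) ^ 2 * (n + i + j + 1) * (n + 2 - i - j) * (n + 2 + i - j) *
      (n + 2 + j - i) * doubleKernel n i j := by
  rw [doubleTerm, doubleKernel,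
    invFact_eq_mul_of_eq (m := ((n + 1 : ℕ) : ℤ) - i - j) (m' := n + 2 - i - j)
      (x := n + 2 - i - j) (by push_cast; ring) (by push_cast; ring),
    invFact_eq_mul_of_eq (m := ((n + 1 : ℕ) : ℤ) + i - j) (m' := n + 2 + i - j)
      (x := n + 2 + i - j) (by push_cast; ring) (by push_cast; ring),
    invFact_eq_mul_of_eq (m := ((n + 1 : ℕ) : ℤ) + j - i) (m' := n + 2 + j - i)
      (x := n + 2 + j - i) (by push_cast; ring) (by push_cast; ring),
    show n + 1 + i + j = n + i + j + 1 by ring, factorial_succ, factorial_succ]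
  push_cast
  ring

theorem doubleTerm_two (n i j : ℕ) : doubleTerm (n + 2) i j =
    16 * (((n : ℚ) + 1) * (n + 2)) ^ 2 * ((n + i + j + 1) * (n + i + j + 2)) *
      doubleKernel n i j := by
  rw [doubleTerm, doubleKernel, show n + 2 + i + j = n + i + j + 1 + 1 by ring,
    factorial_succ (n + i + j + 1), factorial_succ (n + i + j), factorial_succ (n + 1),
    factorial_succ n]
  push_cast
  ring

theorem doubleKernel_succ (n i j : ℕ) :
    ((i : ℚ) + 1) ^ 2 * (n + 3 + i - j) * doubleKernel n (i + 1) j =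
      -1 / 4 * (n + i + j + 1) * (n + 2 - i - j) * (n + 2 + j - i) * doubleKernel n i j := by
  rw [doubleKernel, doubleKernel,
    invFact_eq_mul_of_eq (m := (n : ℤ) + 2 - (i + 1 : ℕ) - j) (m' := n + 2 - i - j)
      (x := n + 2 - i - j) (by push_cast; ring) (by push_cast; ring),
    invFact_eq_mul_of_eq (m := (n : ℤ) + 2 + i - j) (m' := n + 2 + (i + 1 : ℕ) - j)
      (x := n + 3 + i - j) (by push_cast; ring) (by push_cast; ring),
    invFact_eq_mul_of_eq (m := (n : ℤ) + 2 + j - (i + 1 : ℕ)) (m' := n + 2 + j - i)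
      (x := n + 2 + j - i) (by push_cast; ring) (by push_cast; ring),
    show n + (i + 1) + j = n + i + j + 1 by ring, show i + 1 + j = i + j + 1 by ring,
    factorial_succ (n + i + j), factorial_succ i, pow_succ (-1 / 4 : ℚ)]
  have := factorial_ne_zero i
  have := factorial_ne_zero j
  push_cast
  field_simp

theorem doubleAnti_succ (n i j : ℕ) : doubleAnti n (i + 1) j =
    -1 / 4 * ((n : ℚ) + i + j + 1) * (n + 2 - i - j) * (n + 2 + j - i) *
      doubleCert n (i + 1) j * doubleKernel n i j := by
  have h := doubleKernel_succ n i j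
  rw [doubleAnti]
  push_cast
  linear_combination doubleCert n (i + 1) j * h

theorem doubleTerm_telescope (n i j : ℕ) :
    ((n : ℚ) + 2) ^ 2 * doubleTerm (n + 2) i j -
      (7 * ((n : ℚ) + 1) ^ 2 + 7 * (n + 1) + 2) * doubleTerm (n + 1) i j -
      8 * ((n : ℚ) + 1) ^ 2 * doubleTerm n i j =
    (doubleAnti n (i + 1) j - doubleAnti n i j) + (doubleAnti n (j + 1) i - doubleAnti n j i) := by
  rw [doubleTerm_zero n, doubleTerm_one n, doubleTerm_two, doubleAnti_succ, doubleAnti_succ,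
    doubleAnti, doubleAnti, doubleKernel_symm n j i]
  simp only [doubleCert]
  ring

theorem sum_doubleAnti_sub (n j : ℕ) :
    ∑ i ∈ range (n + 3), (doubleAnti n (i + 1) j - doubleAnti n i j) = 0 := by
  rw [sum_range_sub fun i => doubleAnti n i j]
  rw [doubleAnti, doubleKernel,
    invFact_of_neg (show (n : ℤ) + 2 - (n + 3 : ℕ) - j < 0 by omega)]
  simp [doubleAnti]

theorem doubleTerm_eq_zero {n i j : ℕ} (h : n < i + j) : doubleTerm n i j = 0 := by
  rw [doubleTerm, invFact_of_neg (show (n : ℤ) - i - j < 0 by omega)]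
  ring

/-- The double sum over the triangle `i + j ≤ n`, organised along antidiagonals. -/
def doubleSum (n : ℕ) : ℚ :=
  ∑ k ∈ range (n + 1), ∑ i ∈ range (k + 1), doubleTerm n i (k - i)

theorem doubleSum_eq_sum_square {n M : ℕ} (h : n + 1 ≤ M) :
    doubleSum n = ∑ i ∈ range M, ∑ j ∈ range M, doubleTerm n i j := by
  rw [doubleSum, sum_range_diag_flip (n + 1) fun i j => doubleTerm n i j]
  have inner (i : ℕ) : ∑ j ∈ range (n + 1 - i), doubleTerm n i j =
      ∑ j ∈ range M, doubleTerm n i j := by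
    refine sum_subset (range_subset_range.2 (by omega)) fun j _ hj => ?_
    rw [mem_range, not_lt] at hj
    exact doubleTerm_eq_zero (by omega)
  rw [sum_congr rfl fun i _ => inner i]
  refine sum_subset (range_subset_range.2 h) fun i _ hi => ?_
  rw [mem_range, not_lt] at hi
  exact sum_eq_zero fun j _ => doubleTerm_eq_zero (by omega)

theorem franelRec_doubleSum : FranelRec doubleSum := by
  intro n
  rw [doubleSum_eq_sum_square (n := n) (M := n + 3) (by omega),
    doubleSum_eq_sum_square (n := n + 1) (M := n + 3) (by omega),
    doubleSum_eq_sum_square (n := n + 2) (M := n + 3) (by omega), ← sub_eq_zero, ← sub_sub]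
  simp only [mul_sum, ← sum_sub_distrib, doubleTerm_telescope]
  simp only [sum_add_distrib, sum_doubleAnti_sub, add_zero]
  rw [sum_comm]
  simp only [sum_doubleAnti_sub, sum_const_zero]

theorem sSeq_term_eq {n k i : ℕ} (hk : k ≤ n) (hi : i ≤ k) :
    (n.choose k : ℚ) * (-1) ^ k * 4 ^ (n - k) * (1 / ((n + k).choose k : ℚ) *
      (((n + k).choose (2 * i) : ℚ) * ((n + k).choose (2 * (k - i)) : ℚ) *
        ((2 * i).choose i : ℚ) * ((2 * (k - i)).choose (k - i) : ℚ))) =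
      doubleTerm n i (k - i) := by
  obtain ⟨j, rfl⟩ := Nat.exists_eq_add_of_le hi
  obtain ⟨m, rfl⟩ := Nat.exists_eq_add_of_le hk
  rw [Nat.add_sub_cancel_left, Nat.add_sub_cancel_left, doubleTerm,
    choose_eq_invFact (i + j + m + (i + j)) (2 * i),
    choose_eq_invFact (i + j + m + (i + j)) (2 * j),
    choose_eq_invFact (2 * i) i, choose_eq_invFact (2 * j) j,
    Nat.cast_add_choose ℚ, add_comm (i + j + m) (i + j), Nat.cast_add_choose ℚ,
    add_comm (i + j) (i + j + m),
    show ((2 * i : ℕ) : ℤ) - i = i by push_cast; ring,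
    show ((2 * j : ℕ) : ℤ) - j = j by push_cast; ring,
    show ((i + j + m : ℕ) : ℤ) - i - j = m by push_cast; ring,
    show ((i + j + m + (i + j) : ℕ) : ℤ) - (2 * i : ℕ) = (i + j + m : ℕ) + j - i by
      push_cast; ring,
    show ((i + j + m + (i + j) : ℕ) : ℤ) - (2 * j : ℕ) = (i + j + m : ℕ) + i - j by
      push_cast; ring,
    invFact_natCast, invFact_natCast, invFact_natCast,
    show i + j + m + i + j = i + j + m + (i + j) by ring, pow_add 4 (i + j) m, div_pow]
  have := factorial_ne_zero i
  have := factorial_ne_zero j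
  have := factorial_ne_zero m
  have := factorial_ne_zero (2 * i)
  have := factorial_ne_zero (2 * j)
  have := factorial_ne_zero (i + j)
  have := factorial_ne_zero (i + j + m)
  have := factorial_ne_zero (i + j + m + (i + j))
  field_simp

theorem sum_sSeq_eq_doubleSum (n : ℕ) :
    ∑ k ∈ range (n + 1), (n.choose k : ℚ) * (-1) ^ k * 4 ^ (n - k) * sSeq (n + k) k =
      doubleSum n := by
  refine sum_congr rfl fun k hk => ?_
  rw [sSeq, mul_sum, mul_sum]
  refine sum_congr rfl fun i hi => ?_
  exact sSeq_term_eq (Nat.lt_succ_iff.1 (mem_range.1 hk)) (Nat.lt_succ_iff.1 (mem_range.1 hi))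

theorem stmt_16 (n : ℕ) :
    ∑ k ∈ Finset.range (n + 1), (n.choose k : ℚ) * (-1) ^ k * 4 ^ (n - k) * sSeq (n + k) k =
      ∑ k ∈ Finset.range (n + 1), (n.choose k : ℚ) ^ 3 := by
  rw [sum_sSeq_eq_doubleSum]
  refine franelRec_doubleSum.eq franelRec_sum_choose_cube ?_ ?_ n
  · rw [← sum_sSeq_eq_doubleSum]
    simp [sSeq]
  · rw [← sum_sSeq_eq_doubleSum]
    norm_num [sSeq, sum_range_succ, Nat.choose]
end

section
/- Let p > 3 be a prime and define w_n = sum over k from 0 to floor(n/3) of (-1)^k * 3^{n-3k} * C(n,3k) * C(3k,k) * C(2k,k). Then for every k in {0, 1, ..., p-1}, w_k ≡ legendreSym p (-3) * 27^k * w_{p-1-k} (mod p). -/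
/-- Zagier's sequence `w_n = ∑_{k=0}^{⌊n/3⌋} (-1)^k 3^{n-3k} C(n,3k) C(3k,k) C(2k,k)`. -/
def zagierW (n : ℕ) : ℤ :=
  ∑ k ∈ Finset.range (n / 3 + 1),
    (-1 : ℤ) ^ k * 3 ^ (n - 3 * k) * (n.choose (3 * k) : ℤ) *
      ((3 * k).choose k : ℤ) * ((2 * k).choose k : ℤ)

/-- The multinomial coefficient `(3k)! / k!^3`. -/
def trinom (k : ℕ) : ℕ := (3 * k).choose k * (2 * k).choose k

lemma trinom_mul_factorial (k : ℕ) : trinom k * k.factorial ^ 3 = (3 * k).factorial := by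
  have h₁ := Nat.add_choose_mul_factorial_mul_factorial (2 * k) k
  have h₂ := Nat.add_choose_mul_factorial_mul_factorial k k
  rw [show 2 * k + k = 3 * k by ring] at h₁
  rw [show k + k = 2 * k by ring] at h₂
  rw [← h₁, ← h₂, trinom]
  ring

lemma trinom_succ (k : ℕ) :
    trinom (k + 1) * (k + 1) ^ 2 = 3 * (3 * k + 1) * (3 * k + 2) * trinom k := by
  have h₁ := trinom_mul_factorial (k + 1)
  rw [show 3 * (k + 1) = 3 * k + 1 + 1 + 1 by ring] at h₁
  simp only [Nat.factorial_succ] at h₁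
  rw [← trinom_mul_factorial k] at h₁
  have hpos : 0 < (k + 1) * k.factorial ^ 3 := by positivity
  apply Nat.eq_of_mul_eq_mul_right hpos
  linear_combination h₁

lemma zagierW_eq_sum (n N : ℕ) (hN : n / 3 < N) :
    (zagierW n : ℚ) =
      ∑ k ∈ Finset.range N, 3 ^ n * (-1 / 27 : ℚ) ^ k * (n.choose (3 * k) : ℚ) * trinom k := by
  have hsub : Finset.range (n / 3 + 1) ⊆ Finset.range N :=
    Finset.range_subset_range.mpr hN
  rw [← Finset.sum_subset hsub]
  · rw [zagierW]
    push_cast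
    refine Finset.sum_congr rfl fun k hk => ?_
    have hk' : 3 * k ≤ n := by
      rw [Finset.mem_range] at hk
      omega
    rw [trinom, pow_sub₀ _ (by norm_num) hk', pow_mul, div_pow]
    push_cast
    norm_num
    ring
  · intro k _ hk
    rw [Finset.mem_range] at hk
    rw [Nat.choose_eq_zero_of_lt (by omega)]
    simp

lemma cast_choose_succ_mul {R : Type*} [CommRing R] (n j : ℕ) :
    (n.choose (j + 1) : R) * (j + 1) = n.choose j * (n - j) := by
  rcases le_or_gt j n with h | h
  · rw [← Nat.cast_sub h]
    exact_mod_cast congrArg (Nat.cast (R := R)) (Nat.choose_succ_right_eq n j)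
  · simp [Nat.choose_eq_zero_of_lt h, Nat.choose_eq_zero_of_lt (Nat.lt_succ_of_lt h)]

/-- The contiguity relation behind the recurrence of `zagierW`. -/
lemma choose_contiguous (n i : ℕ) :
    3 * ((n : ℚ) + 2) ^ 2 * ((n + 2).choose (i + 2) : ℚ)
      - (9 * ((n : ℚ) + 1) * (n + 2) + 3) * ((n + 1).choose (i + 2) : ℚ)
      + 9 * ((n : ℚ) + 1) ^ 2 * (n.choose (i + 2) : ℚ)
      - 3 * ((i : ℚ) + 2) ^ 2 * ((n + 1).choose (i + 1) : ℚ)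
    = 3 * ((n : ℚ) - i - 1) * (n - i - 2) * ((n + 1).choose (i + 2) : ℚ) := by
  have h₁ := cast_choose_succ_mul (R := ℚ) n i
  have h₂ := cast_choose_succ_mul (R := ℚ) n (i + 1)
  simp only [Nat.choose_succ_succ']
  push_cast at h₁ h₂ ⊢
  linear_combination (6 * (n : ℚ) + 3 - 3 * (i + 2)) * h₂ - 3 * ((n : ℚ) + 2 + (i + 2)) * h₁

lemma choose_mul_falling (n i : ℕ) :
    ((n : ℚ) - i) * (n - i - 1) * (n.choose i : ℚ) =
      ((i : ℚ) + 1) * (i + 2) * (n.choose (i + 2) : ℚ) := by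
  have h₁ := cast_choose_succ_mul (R := ℚ) n i
  have h₂ := cast_choose_succ_mul (R := ℚ) n (i + 1)
  push_cast at h₁ h₂
  linear_combination (-((n : ℚ) - i - 1)) * h₁ - ((i : ℚ) + 1) * h₂

lemma sum_range_zeilberger (n N : ℕ) :
    ∑ k ∈ Finset.range (N + 1), (-1 / 27 : ℚ) ^ k * trinom k *
      (3 * ((n : ℚ) + 2) ^ 2 * ((n + 2).choose (3 * k) : ℚ)
        - (9 * ((n : ℚ) + 1) * (n + 2) + 3) * ((n + 1).choose (3 * k) : ℚ)
        + 9 * ((n : ℚ) + 1) ^ 2 * (n.choose (3 * k) : ℚ)) =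
    (-1 / 27 : ℚ) ^ N * trinom N *
      (3 * ((n : ℚ) + 1 - 3 * N) * (n - 3 * N) * ((n + 1).choose (3 * N) : ℚ)) := by
  induction N with
  | zero =>
    simp [trinom]
    ring
  | succ N ih =>
    rw [Finset.sum_range_succ, ih]
    have h₁ := choose_contiguous n (3 * N + 1)
    have h₂ := choose_mul_falling (n + 1) (3 * N)
    have h₃ : (trinom (N + 1) : ℚ) * (N + 1) ^ 2 = 3 * (3 * N + 1) * (3 * N + 2) * trinom N := by
      exact_mod_cast trinom_succ N
    rw [show 3 * N + 1 + 2 = 3 * (N + 1) by ring, show 3 * N + 1 + 1 = 3 * N + 2 by ring] at h₁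
    push_cast at h₁ h₂ ⊢
    rw [pow_succ]
    linear_combination (-1 / 27 : ℚ) ^ N * (-1 / 27) * trinom (N + 1) * h₁ +
      3 * (-1 / 27 : ℚ) ^ N * trinom N * h₂ -
      (-1 / 27 : ℚ) ^ N * ((n + 1).choose (3 * N + 2) : ℚ) * h₃

/-- The three-term recurrence of `zagierW`. -/
lemma zagierW_recurrence (n : ℕ) :
    ((n : ℤ) + 2) ^ 2 * zagierW (n + 2) =
      (9 * (n + 1) * (n + 2) + 3) * zagierW (n + 1) - 27 * (n + 1) ^ 2 * zagierW n := by
  have h := sum_range_zeilberger n (n + 2)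
  rw [Nat.choose_eq_zero_of_lt (show n + 1 < 3 * (n + 2) by omega)] at h
  have key : ((n : ℚ) + 2) ^ 2 * zagierW (n + 2) -
      (9 * (n + 1) * (n + 2) + 3) * zagierW (n + 1) + 27 * (n + 1) ^ 2 * zagierW n = 0 := by
    rw [zagierW_eq_sum (n + 2) (n + 2 + 1) (by omega),
      zagierW_eq_sum (n + 1) (n + 2 + 1) (by omega), zagierW_eq_sum n (n + 2 + 1) (by omega),
      Finset.mul_sum, Finset.mul_sum, Finset.mul_sum, ← Finset.sum_sub_distrib,
      ← Finset.sum_add_distrib]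
    rw [Nat.cast_zero, mul_zero, mul_zero] at h
    rw [← mul_zero (3 ^ (n + 1) : ℚ), ← h, Finset.mul_sum]
    exact Finset.sum_congr rfl fun k _ => by ring
  have key' : ((n : ℤ) + 2) ^ 2 * zagierW (n + 2) -
      (9 * (n + 1) * (n + 2) + 3) * zagierW (n + 1) + 27 * (n + 1) ^ 2 * zagierW n = 0 := by
    exact_mod_cast key
  linear_combination key'

lemma sum_neg_one_pow_choose_mul_choose (m : ℕ) :
    ∑ k ∈ Finset.range (m + 1), (-1 : ℤ) ^ k * m.choose k * (m + k).choose m = (-1) ^ m := by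
  have h := Polynomial.shiftedLegendre_eval_symm m (0 : ℤ)
  have h₀ : Polynomial.aeval (0 : ℤ) (Polynomial.shiftedLegendre m) = 1 := by
    rw [← Polynomial.coeff_zero_eq_aeval_zero, Polynomial.coeff_shiftedLegendre]
    simp
  have h₁ : Polynomial.aeval (1 : ℤ) (Polynomial.shiftedLegendre m) =
      ∑ k ∈ Finset.range (m + 1), (-1 : ℤ) ^ k * m.choose k * (m + k).choose m := by
    simp [Polynomial.shiftedLegendre]
  rw [h₀, sub_zero, h₁] at h
  rcases neg_one_pow_eq_or ℤ m with hs | hs <;> rw [hs] at h ⊢ <;> linarith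

section ModPrime

variable {p : ℕ} [Fact p.Prime]

lemma natCast_succ_ne_zero {k : ℕ} (hk : k + 1 < p) : (k : ZMod p) + 1 ≠ 0 := by
  intro h
  have h' : ((k + 1 : ℕ) : ZMod p) = 0 := by exact_mod_cast h
  exact absurd (Nat.le_of_dvd k.succ_pos ((ZMod.natCast_eq_zero_iff _ _).mp h')) (by omega)

lemma trinom_eq_choose_mul_choose {m : ℕ} (hm : (3 * (m : ZMod p) + 1) * (3 * m + 2) = 0)
    (k : ℕ) (hk : k < p) :
    (trinom k : ZMod p) = (-27) ^ k * m.choose k * (m + k).choose m := by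
  induction k with
  | zero => simp [trinom]
  | succ k ih =>
    have ih := ih (by omega)
    have h₁ : (trinom (k + 1) : ZMod p) * (k + 1) ^ 2 =
        3 * (3 * k + 1) * (3 * k + 2) * trinom k := by
      exact_mod_cast congrArg (Nat.cast (R := ZMod p)) (trinom_succ k)
    have h₂ := cast_choose_succ_mul (R := ZMod p) m k
    have h₃ : ((m + (k + 1)).choose m : ZMod p) * (k + 1) = (m + k).choose m * (m + k + 1) := by
      have := Nat.choose_mul_succ_eq (m + k) m
      rw [show m + k + 1 - m = k + 1 by omega] at this
      exact_mod_cast congrArg (Nat.cast (R := ZMod p)) this.symm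
    have hne : ((k : ZMod p) + 1) ^ 2 ≠ 0 := pow_ne_zero _ (natCast_succ_ne_zero hk)
    apply mul_right_cancel₀ hne
    rw [h₁, ih, pow_succ]
    linear_combination (-(-27 : ZMod p) ^ k * -27 * ((m + (k + 1)).choose m) * (k + 1)) * h₂ -
      (-27 : ZMod p) ^ k * -27 * (m.choose k) * (m - k) * h₃ +
      3 * (-27 : ZMod p) ^ k * m.choose k * (m + k).choose m * hm

lemma choose_prime_sub_one (j : ℕ) (hj : j < p) : ((p - 1).choose j : ZMod p) = (-1) ^ j := by
  induction j with
  | zero => simp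
  | succ j ih =>
    have hp : p - 1 + 1 = p := by omega
    have h := Nat.choose_succ_succ' (p - 1) j
    rw [hp] at h
    have h0 : (p.choose (j + 1) : ZMod p) = 0 :=
      (ZMod.natCast_eq_zero_iff _ _).mpr ((Fact.out : p.Prime).dvd_choose_self (by omega) hj)
    rw [h] at h0
    push_cast at h0
    rw [ih (by omega)] at h0
    rw [pow_succ]
    linear_combination h0

lemma zagierW_prime_sub_one {m : ℕ} (hp : 3 < p) (hm : (p - 1) / 3 = m)
    (hm' : (3 * (m : ZMod p) + 1) * (3 * m + 2) = 0) :
    (zagierW (p - 1) : ZMod p) = (-1) ^ m := by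
  have h3 : (3 : ZMod p) ≠ 0 := by
    have := natCast_succ_ne_zero (p := p) (k := 2) hp
    norm_num at this
    exact this
  have hsum := congrArg (Int.cast (R := ZMod p)) (sum_neg_one_pow_choose_mul_choose m)
  push_cast at hsum
  rw [← hsum, zagierW, hm]
  push_cast
  refine Finset.sum_congr rfl fun k hk => ?_
  have hk' : 3 * k ≤ p - 1 := by
    rw [Finset.mem_range] at hk
    omega
  have ht := trinom_eq_choose_mul_choose hm' k (by omega)
  rw [trinom] at ht
  push_cast at ht
  rw [choose_prime_sub_one _ (by omega), mul_assoc, ht, pow_sub₀ _ h3 hk',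
    ZMod.pow_card_sub_one_eq_one h3, pow_mul, pow_mul]
  have h27 : (3 ^ 3 : ZMod p) ^ k ≠ 0 := pow_ne_zero _ (pow_ne_zero _ h3)
  rw [show (-27 : ZMod p) = (-1) * 3 ^ 3 by norm_num, mul_pow (-1 : ZMod p)]
  field_simp
  rw [← pow_mul, mul_comm k, pow_mul]
  simp

lemma legendreSym_neg_three (hp : 3 < p) :
    legendreSym p (-3) = legendreSym 3 p := by
  have hp2 : p ≠ 2 := by omega
  have hrec := legendreSym.quadratic_reciprocity' (p := 3) (q := p) (by norm_num) hp2
  rw [show (-3 : ℤ) = -1 * (3 : ℕ) by norm_num, legendreSym.mul, hrec,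
    legendreSym.at_neg_one hp2,
    ZMod.χ₄_eq_neg_one_pow ((Fact.out : p.Prime).eq_two_or_odd.resolve_left hp2), ← mul_assoc,
    ← pow_add]
  rw [show p / 2 + 3 / 2 * (p / 2) = 2 * (p / 2) by omega, pow_mul]
  simp

lemma zagierW_prime_sub_one_eq_legendreSym (hp : 3 < p) :
    (zagierW (p - 1) : ZMod p) = legendreSym p (-3) := by
  have hprime : p.Prime := Fact.out
  have hodd : p % 2 = 1 := hprime.eq_two_or_odd.resolve_left (by omega)
  have hmod : p % 3 ≠ 0 := fun h =>
    absurd ((Nat.prime_dvd_prime_iff_eq Nat.prime_three hprime).mp (Nat.dvd_of_mod_eq_zero h))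
      (by omega)
  rw [legendreSym_neg_three hp, legendreSym.mod]
  obtain h | h : p % 3 = 1 ∨ p % 3 = 2 := by omega
  · have hcast : 3 * (((p - 1) / 3 : ℕ) : ZMod p) + 1 = 0 := by
      have := congrArg (Nat.cast (R := ZMod p)) (show p = 3 * ((p - 1) / 3) + 1 by omega)
      rw [ZMod.natCast_self] at this
      exact_mod_cast this.symm
    rw [zagierW_prime_sub_one hp rfl (by rw [hcast, zero_mul]), Even.neg_one_pow,
      show ((p : ℤ) % (3 : ℕ)) = 1 by omega]
    · simp
    · rw [Nat.even_iff]
      omega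
  · have hcast : 3 * (((p - 1) / 3 : ℕ) : ZMod p) + 2 = 0 := by
      have := congrArg (Nat.cast (R := ZMod p)) (show p = 3 * ((p - 1) / 3) + 2 by omega)
      rw [ZMod.natCast_self] at this
      exact_mod_cast this.symm
    rw [zagierW_prime_sub_one hp rfl (by rw [hcast, mul_zero]), Odd.neg_one_pow,
      show ((p : ℤ) % (3 : ℕ)) = 2 by omega, show legendreSym 3 2 = -1 by decide]
    · simp
    · rw [Nat.odd_iff]
      omega

/-- Modulo `p`, reflecting `zagierW` gives another solution of its recurrence. -/
lemma zagierW_reflect (k : ℕ) (hk : k < p) :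
    (27 : ZMod p) ^ k * zagierW (p - 1 - k) = zagierW (p - 1) * zagierW k := by
  have hrec (n : ℕ) : ((n : ZMod p) + 2) ^ 2 * zagierW (n + 2) =
      (9 * (n + 1) * (n + 2) + 3) * zagierW (n + 1) - 27 * (n + 1) ^ 2 * zagierW n := by
    exact_mod_cast congrArg (Int.cast (R := ZMod p)) (zagierW_recurrence n)
  induction k using Nat.twoStepInduction with
  | zero => simp [zagierW]
  | one =>
    obtain ⟨n, rfl⟩ : ∃ n, p = n + 2 := ⟨p - 2, by omega⟩
    have h := hrec n
    have hn : (n : ZMod (n + 2)) + 2 = 0 := by exact_mod_cast ZMod.natCast_self (n + 2)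
    have hw : zagierW 1 = 3 := by decide
    rw [hw, show n + 2 - 1 - 1 = n by omega, show n + 2 - 1 = n + 1 by omega]
    push_cast
    rw [eq_sub_of_add_eq hn] at h
    linear_combination h
  | more k ih₀ ih₁ =>
    obtain ⟨n, rfl⟩ : ∃ n, p = n + k + 3 := ⟨p - k - 3, by omega⟩
    have ih₀ := ih₀ (by omega)
    have ih₁ := ih₁ (by omega)
    rw [show n + k + 3 - 1 - k = n + 2 by omega] at ih₀
    rw [show n + k + 3 - 1 - (k + 1) = n + 1 by omega] at ih₁
    rw [show n + k + 3 - 1 - (k + 2) = n by omega]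
    have h := hrec n
    have hk' := hrec k
    have hn : (n : ZMod (n + k + 3)) = -k - 3 := by
      have : (n : ZMod (n + k + 3)) + k + 3 = 0 := by exact_mod_cast ZMod.natCast_self (n + k + 3)
      linear_combination this
    have hne : ((k : ZMod (n + k + 3)) + 2) ^ 2 ≠ 0 := by
      have := natCast_succ_ne_zero hk
      push_cast at this
      refine pow_ne_zero _ fun h0 => this ?_
      linear_combination h0
    rw [hn] at h
    apply mul_left_cancel₀ hne
    rw [pow_succ] at ih₁
    rw [pow_succ, pow_succ]
    generalize (zagierW (n + k + 3 - 1) : ZMod (n + k + 3)) = c at *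
    linear_combination (27 : ZMod (n + k + 3)) ^ k * 27 * h - c * hk' +
      (9 * ((k : ZMod (n + k + 3)) + 1) * (k + 2) + 3) * ih₁ -
      27 * ((k : ZMod (n + k + 3)) + 1) ^ 2 * ih₀

end ModPrime

theorem stmt_18 (p : ℕ) [Fact p.Prime] (hp : 3 < p) (k : ℕ) (hk : k < p) :
    zagierW k ≡ legendreSym p (-3) * 27 ^ k * zagierW (p - 1 - k) [ZMOD (p : ℤ)] := by
  rw [← ZMod.intCast_eq_intCast_iff]
  have hne : ((-3 : ℤ) : ZMod p) ≠ 0 := by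
    have := natCast_succ_ne_zero (p := p) (k := 2) hp
    norm_num at this
    simpa using this
  have hsq : ((legendreSym p (-3) : ℤ) : ZMod p) ^ 2 = 1 := by
    exact_mod_cast congrArg (Int.cast (R := ZMod p)) (legendreSym.sq_one p hne)
  have h := zagierW_reflect k hk
  rw [zagierW_prime_sub_one_eq_legendreSym hp] at h
  push_cast
  linear_combination (-(zagierW k : ZMod p)) * hsq - (legendreSym p (-3) : ZMod p) * h
end
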